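/- Let R be Noetherian, 𝔞 an ideal, M a nonzero finitely generated R-module with c = cd(𝔞, M) finite, and let M_i be the largest submodule of M with cd(𝔞, M_i) ≤ i. Then Ass_R(M_i) = {𝔭 ∈ Ass_R(M) : cd(𝔞, R/𝔭) ≤ i}. -/

import Mathlib

open CategoryTheory

universe u

/-- `H^i_I(M) ≠ 0`: the `i`-th local cohomology of `M` with respect to `I` is nonzero. -/
abbrev LCNonzero {R : Type u} [CommRing R] (I : Ideal R) (i : ℕ)
    (M : Type u) [AddCommGroup M] [Module R M] : Prop :=
  Nontrivial ((localCohomology I i).obj (ModuleCat.of R M))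

/-- Cohomological dimension `cd(I, M) = sup {i : H^i_I(M) ≠ 0}`, as an element of
`WithBot ℕ∞` (it is `⊥` if all local cohomology of `M` vanishes). -/
noncomputable def cohDim {R : Type u} [CommRing R] (I : Ideal R)
    (M : Type u) [AddCommGroup M] [Module R M] : WithBot ℕ∞ :=
  sSup {n : WithBot ℕ∞ | ∃ i : ℕ, n = (i : ℕ∞) ∧ LCNonzero I i M}

/-- Krull dimension of a module, i.e. the Krull dimension of `R ⧸ Ann_R M`. -/
noncomputable def modDim (R : Type u) [CommRing R]
    (M : Type u) [AddCommGroup M] [Module R M] : WithBot ℕ∞ :=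
  ringKrullDim (R ⧸ Module.annihilator R M)


namespace LCAux

open CategoryTheory Limits Opposite

section oldExt

variable {R : Type u} [CommRing R]

/-- `f` represents the cohomology class `x`. -/
def RepK (K : ChainComplex (ModuleCat.{u} R)ᵒᵖ ℕ) (n : ℕ) (f : (K.X n).unop)
    (x : (K.homology n).unop) : Prop :=
  ∃ c : (K.opcycles n).unop, (K.pOpcycles n).unop c = f ∧ (K.homologyι n).unop c = x

lemma RepK.exists_rep (K : ChainComplex (ModuleCat.{u} R)ᵒᵖ ℕ) (n : ℕ) (x : (K.homology n).unop) :
    ∃ f, RepK K n f x := by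
  have h : Epi (K.homologyι n).unop := inferInstance
  rw [ModuleCat.epi_iff_surjective] at h
  obtain ⟨c, hc⟩ := h x
  exact ⟨_, c, rfl, hc⟩

lemma RepK.cocycle {K : ChainComplex (ModuleCat.{u} R)ᵒᵖ ℕ} {n : ℕ} {f : (K.X n).unop}
    {x : (K.homology n).unop} (h : RepK K n f x) : (K.d (n+1) n).unop f = 0 := by
  obtain ⟨c, rfl, -⟩ := h
  have : K.d (n+1) n ≫ K.pOpcycles n = 0 := by simp
  have := congrArg Quiver.Hom.unop this
  exact congr($this c)

lemma RepK.of_cocycle {K : ChainComplex (ModuleCat.{u} R)ᵒᵖ ℕ} {n : ℕ} {f : (K.X n).unop}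
    (h : (K.d (n+1) n).unop f = 0) : ∃ x, RepK K n f x := by
  have e : (ShortComplex.mk (K.d (n+1) n) (K.pOpcycles n) (by simp)).Exact :=
    ShortComplex.exact_of_g_is_cokernel _ (K.opcyclesIsCokernel (n+1) n (by simp))
  have e2 := e.unop
  rw [ShortComplex.moduleCat_exact_iff] at e2
  obtain ⟨c, hc⟩ := e2 f h
  exact ⟨_, c, hc, rfl⟩

lemma RepK.eq_zero_iff {K : ChainComplex (ModuleCat.{u} R)ᵒᵖ ℕ} {n : ℕ} {f : (K.X (n+1)).unop}
    {x : (K.homology (n+1)).unop} (h : RepK K (n+1) f x) :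
    x = 0 ↔ ∃ g, (K.d (n+1) n).unop g = f := by
  obtain ⟨c, rfl, rfl⟩ := h
  have e : (ShortComplex.mk (K.homologyι (n+1)) (K.fromOpcycles (n+1) n) (by simp)).Exact :=
    ShortComplex.exact_of_f_is_kernel _ (K.homologyIsKernel (n+1) n (by simp))
  have e2 := e.unop
  rw [ShortComplex.moduleCat_exact_iff] at e2
  have hd : K.pOpcycles (n+1) ≫ K.fromOpcycles (n+1) n = K.d (n+1) n := by simp
  have hd' := congrArg Quiver.Hom.unop hd
  constructor
  · intro h0
    obtain ⟨g, hg⟩ := e2 c h0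
    refine ⟨g, ?_⟩
    rw [← hd']
    exact congrArg (K.pOpcycles (n+1)).unop hg
  · rintro ⟨g, hg⟩
    rw [← hd'] at hg
    have hm : Mono (K.pOpcycles (n+1)).unop := inferInstance
    rw [ModuleCat.mono_iff_injective] at hm
    have := hm hg
    rw [← this]
    have h1 : K.homologyι (n+1) ≫ K.fromOpcycles (n+1) n = 0 := by simp
    have h2 := congrArg Quiver.Hom.unop h1
    exact congr($h2 g)

lemma RepK.map {K L : ChainComplex (ModuleCat.{u} R)ᵒᵖ ℕ} (φ : K ⟶ L) {n : ℕ} {f : (L.X n).unop}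
    {x : (L.homology n).unop} (h : RepK L n f x) :
    RepK K n ((φ.f n).unop f) ((HomologicalComplex.homologyMap φ n).unop x) := by
  obtain ⟨c, rfl, rfl⟩ := h
  refine ⟨(HomologicalComplex.opcyclesMap φ n).unop c, ?_, ?_⟩
  · have h1 := congrArg Quiver.Hom.unop (HomologicalComplex.p_opcyclesMap φ n)
    exact congr($h1 c)
  · have h1 := congrArg Quiver.Hom.unop (HomologicalComplex.homologyι_naturality φ n)
    exact congr($h1 c).symm

/-- The old `Ext`. -/
noncomputable abbrev OExt (n : ℕ) (X Y : ModuleCat.{u} R) : ModuleCat.{u} R :=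
  ((Ext R (ModuleCat.{u} R) n).obj (op X)).obj Y

/-- The functor which gets derived. -/
noncomputable abbrev FY (Y : ModuleCat.{u} R) : ModuleCat.{u} R ⥤ (ModuleCat.{u} R)ᵒᵖ :=
  ((linearYoneda R (ModuleCat.{u} R)).obj Y).rightOp

/-- The iso with homology of the resolution. -/
noncomputable def oiso {X : ModuleCat.{u} R} (P : ProjectiveResolution X) (n : ℕ)
    (Y : ModuleCat.{u} R) :
    (((FY Y).mapHomologicalComplex _).obj P.complex).homology n ≅ op (OExt n X Y) :=
  (P.isoLeftDerivedObj (FY Y) n).symm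

/-- A cocycle represents an old ext class -/
def Rep {X : ModuleCat.{u} R} (P : ProjectiveResolution X) (n : ℕ)
    (Y : ModuleCat.{u} R) (f : P.complex.X n ⟶ Y) (x : OExt n X Y) : Prop :=
  RepK (((FY Y).mapHomologicalComplex _).obj P.complex) n f ((oiso P n Y).hom.unop x)

lemma Rep.exists_rep {X : ModuleCat.{u} R} (P : ProjectiveResolution X) (n : ℕ)
    (Y : ModuleCat.{u} R) (x : OExt n X Y) : ∃ f, Rep P n Y f x := by
  obtain ⟨f, hf⟩ := RepK.exists_rep (((FY Y).mapHomologicalComplex _).obj P.complex) n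
    ((oiso P n Y).hom.unop x)
  exact ⟨f, hf⟩

lemma Rep.cocycle {X : ModuleCat.{u} R} {P : ProjectiveResolution X} {n : ℕ}
    {Y : ModuleCat.{u} R} {f : P.complex.X n ⟶ Y} {x : OExt n X Y} (h : Rep P n Y f x) :
    P.complex.d (n+1) n ≫ f = 0 := RepK.cocycle h

lemma Rep.of_cocycle {X : ModuleCat.{u} R} {P : ProjectiveResolution X} {n : ℕ}
    {Y : ModuleCat.{u} R} {f : P.complex.X n ⟶ Y} (h : P.complex.d (n+1) n ≫ f = 0) :
    ∃ x, Rep P n Y f x := by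
  obtain ⟨x, hx⟩ := RepK.of_cocycle (K := ((FY Y).mapHomologicalComplex _).obj P.complex)
    (n := n) (f := f) h
  refine ⟨(oiso P n Y).inv.unop x, ?_⟩
  have : (oiso P n Y).hom.unop ((oiso P n Y).inv.unop x) = x := by
    have h1 := congrArg Quiver.Hom.unop (oiso P n Y).hom_inv_id
    exact congr($h1 x)
  rw [Rep, this]
  exact hx

lemma Rep.eq_zero_iff {X : ModuleCat.{u} R} {P : ProjectiveResolution X} {n : ℕ}
    {Y : ModuleCat.{u} R} {f : P.complex.X (n+1) ⟶ Y} {x : OExt (n+1) X Y}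
    (h : Rep P (n+1) Y f x) : x = 0 ↔ ∃ g, P.complex.d (n+1) n ≫ g = f := by
  refine Iff.trans ?_ (RepK.eq_zero_iff h)
  have hm : Mono (oiso P (n+1) Y).hom.unop := inferInstance
  rw [ModuleCat.mono_iff_injective] at hm
  exact (map_eq_zero_iff _ hm).symm

lemma Rep.map {X X' : ModuleCat.{u} R} {P : ProjectiveResolution X}
    {P' : ProjectiveResolution X'} {n : ℕ} {Y : ModuleCat.{u} R} {f : P.complex.X n ⟶ Y}
    {x : OExt n X Y} (g : X' ⟶ X) (φ : P'.complex ⟶ P.complex)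
    (comm : φ.f 0 ≫ P.π.f 0 = P'.π.f 0 ≫ g)
    (h : Rep P n Y f x) :
    Rep P' n Y (φ.f n ≫ f) (((Ext R (ModuleCat.{u} R) n).map g.op).app Y x) := by
  have h1 := RepK.map (((FY Y).mapHomologicalComplex _).map φ) h
  have h2 := congrArg Quiver.Hom.unop
    (ProjectiveResolution.isoLeftDerivedObj_inv_naturality g P' P φ comm (FY Y) n)
  have h3 : (oiso P' n Y).hom.unop (((Ext R (ModuleCat.{u} R) n).map g.op).app Y x) =
    (HomologicalComplex.homologyMap (((FY Y).mapHomologicalComplex _).map φ) n).unop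
      ((oiso P n Y).hom.unop x) := congr($h2 x)
  rw [Rep, h3]
  exact h1

end oldExt

section newExt

variable {R : Type u} [CommRing R]

lemma old_zero_iff_new {X X' Y : ModuleCat.{u} R} (P : ProjectiveResolution X)
    (P' : ProjectiveResolution X') (g : X' ⟶ X) {n : ℕ} {f : P.complex.X (n+1) ⟶ Y}
    (hf : P.complex.d (n+1+1) (n+1) ≫ f = 0)
    {x : OExt (n+1) X Y} (h : Rep P (n+1) Y f x) :
    ((Ext R (ModuleCat.{u} R) (n+1)).map g.op).app Y x = 0 ↔
      (Abelian.Ext.mk₀ g).comp (P.extMk f (n+1+1) rfl hf) (zero_add _) = 0 := by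
  let φ : ProjectiveResolution.Hom P' P g :=
    { hom := ProjectiveResolution.lift g P' P
      hom_f_zero_comp_π_f_zero := ProjectiveResolution.lift_commutes_zero g P' P }
  rw [ProjectiveResolution.mk₀_comp_extMk f _ rfl hf φ,
    ProjectiveResolution.extMk_eq_zero_iff _ _ _ _ _ n rfl]
  exact Rep.eq_zero_iff (Rep.map g φ.hom (ProjectiveResolution.lift_commutes_zero g P' P) h)

/-- the quotients by powers -/
abbrev QP (I : Ideal R) (t : ℕ) : ModuleCat.{u} R := ModuleCat.of R (R ⧸ I ^ t)

/-- transition maps -/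
def tr (I : Ideal R) {t s : ℕ} (h : t ≤ s) : QP I s ⟶ QP I t :=
  (localCohomology.ringModIdeals (localCohomology.idealPowersDiagram I)).map (homOfLE h).op

/-- vanishing of `H^n_I(Y)` in terms of ext classes -/
def Van (I : Ideal R) (n : ℕ) (Y : ModuleCat.{u} R) : Prop :=
  ∀ (t : ℕ) (α : Abelian.Ext (QP I t) Y n), ∃ (s : ℕ) (h : t ≤ s),
    (Abelian.Ext.mk₀ (tr I h)).comp α (zero_add _) = 0

lemma van_iff_old (I : Ideal R) (n : ℕ) (Y : ModuleCat.{u} R) :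
    Van I (n+1) Y ↔ ∀ (t : ℕ) (x : OExt (n+1) (QP I t) Y), ∃ (s : ℕ) (h : t ≤ s),
      ((Ext R (ModuleCat.{u} R) (n+1)).map (tr I h).op).app Y x = 0 := by
  constructor
  · intro H t x
    obtain ⟨f, hf⟩ := Rep.exists_rep (projectiveResolution (QP I t)) (n+1) Y x
    obtain ⟨s, h, hs⟩ := H t ((projectiveResolution (QP I t)).extMk f (n+1+1) rfl hf.cocycle)
    exact ⟨s, h, (old_zero_iff_new _ (projectiveResolution _) _ hf.cocycle hf).2 hs⟩
  · intro H t α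
    obtain ⟨f, hf, rfl⟩ := (projectiveResolution (QP I t)).extMk_surjective α (n+1+1) rfl
    obtain ⟨x, hx⟩ := Rep.of_cocycle hf
    obtain ⟨s, h, hs⟩ := H t x
    exact ⟨s, h, (old_zero_iff_new _ (projectiveResolution _) _ hf hx).1 hs⟩

lemma subsingleton_iff_old (I : Ideal R) (n : ℕ) (Y : ModuleCat.{u} R) :
    Subsingleton ((localCohomology I n).obj Y) ↔
    ∀ (t : ℕ) (x : OExt n (QP I t) Y), ∃ (s : ℕ) (h : t ≤ s),
      ((Ext R (ModuleCat.{u} R) n).map (tr I h).op).app Y x = 0 := by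
  have hc := isColimitOfPreserves ((evaluation (ModuleCat.{u} R) (ModuleCat.{u} R)).obj Y)
    (colimit.isColimit (localCohomology.diagram (localCohomology.idealPowersDiagram I) n))
  have : PreservesFilteredColimitsOfSize.{0, 0} (forget (ModuleCat.{u} R)) :=
    preservesFilteredColimitsOfSize_shrink.{0, u, 0, u} _
  constructor
  · intro hs t x
    have h0 := hs.elim ((((evaluation (ModuleCat.{u} R) (ModuleCat.{u} R)).obj Y).mapCocone
      (colimit.cocone (localCohomology.diagram (localCohomology.idealPowersDiagram I) n))).ι.app
        (op (op t)) x) ((((evaluation (ModuleCat.{u} R) (ModuleCat.{u} R)).obj Y).mapCocone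
      (colimit.cocone (localCohomology.diagram (localCohomology.idealPowersDiagram I) n))).ι.app
        (op (op t)) 0)
    obtain ⟨k, f, g, hfg⟩ := (Concrete.isColimit_rep_eq_iff_exists _ hc _ _).1 h0
    refine ⟨k.unop.unop, leOfHom f.unop.unop, ?_⟩
    rw [map_zero] at hfg
    exact hfg
  · intro H
    suffices h : ∀ y : (localCohomology I n).obj Y, y = 0 from
      ⟨fun a b => (h a).trans (h b).symm⟩
    intro y
    obtain ⟨j, x, hx⟩ := Concrete.isColimit_exists_rep _ hc y
    obtain ⟨s, h, hs⟩ := H j.unop.unop x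
    have h1 := (((evaluation (ModuleCat.{u} R) (ModuleCat.{u} R)).obj Y).mapCocone
      (colimit.cocone (localCohomology.diagram
        (localCohomology.idealPowersDiagram I) n))).w ((homOfLE h).op.op : j ⟶ op (op s))
    have h2 := congr($h1 x)
    rw [← hx]
    refine h2.symm.trans ?_
    have h3 : ∀ z, z = 0 → (((evaluation (ModuleCat.{u} R) (ModuleCat.{u} R)).obj Y).mapCocone
      (colimit.cocone (localCohomology.diagram
        (localCohomology.idealPowersDiagram I) n))).ι.app (op (op s)) z = 0 := by
      rintro _ rfl
      exact map_zero _
    exact h3 _ hs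

lemma van_iff (I : Ideal R) (n : ℕ) (Y : ModuleCat.{u} R) :
    Van I (n+1) Y ↔ ¬ LCNonzero I (n+1) Y := by
  rw [van_iff_old, ← subsingleton_iff_old, not_nontrivial_iff_subsingleton]

end newExt

section chases

open Abelian.Ext

variable {R : Type u} [CommRing R]

/-- projections between cyclic modules -/
def pj {A B : Ideal R} (h : A ≤ B) : ModuleCat.of R (R ⧸ A) ⟶ ModuleCat.of R (R ⧸ B) :=
  ModuleCat.ofHom (Submodule.mapQ A B LinearMap.id h)

lemma tr_eq_pj (I : Ideal R) {t s : ℕ} (h : t ≤ s) : tr I h = pj (Ideal.pow_le_pow_right h) := rfl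

lemma pj_comp {A B C : Ideal R} (h : A ≤ B) (h' : B ≤ C) : pj h ≫ pj h' = pj (h.trans h') := by
  ext
  rfl

lemma tr_comp (I : Ideal R) {t s r : ℕ} (h : t ≤ s) (h' : s ≤ r) :
    tr I h' ≫ tr I h = tr I (h.trans h') := by
  simp only [tr_eq_pj, pj_comp]

lemma tr_comp_ext (I : Ideal R) {t s r : ℕ} (h : t ≤ s) (h' : s ≤ r) {Y : ModuleCat.{u} R}
    {n : ℕ} (α : Abelian.Ext (QP I t) Y n) :
    (mk₀ (tr I (h.trans h'))).comp α (zero_add _) =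
    (mk₀ (tr I h')).comp ((mk₀ (tr I h)).comp α (zero_add _)) (zero_add _) := by
  rw [← tr_comp I h h', mk₀_comp_mk₀_assoc]

lemma Van.X₂ {I : Ideal R} {n : ℕ} {S : ShortComplex (ModuleCat.{u} R)} (hS : S.ShortExact)
    (h1 : Van I n S.X₁) (h3 : Van I n S.X₃) : Van I n S.X₂ := by
  intro t α
  obtain ⟨s, hs, e⟩ := h3 t (α.comp (mk₀ S.g) (add_zero _))
  rw [← comp_assoc _ _ _ (zero_add n) (add_zero n) (by simp)] at e
  obtain ⟨β, hβ⟩ := covariant_sequence_exact₂ _ hS _ e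
  obtain ⟨s', hs', e'⟩ := h1 s β
  refine ⟨s', hs.trans hs', ?_⟩
  rw [tr_comp_ext I hs hs', ← hβ, ← comp_assoc _ _ _ (zero_add n) (add_zero n) (by simp), e', Abelian.Ext.zero_comp]

lemma Van.X₃ {I : Ideal R} {n : ℕ} {S : ShortComplex (ModuleCat.{u} R)} (hS : S.ShortExact)
    (h2 : Van I n S.X₂) (h1 : Van I (n+1) S.X₁) : Van I n S.X₃ := by
  intro t α
  obtain ⟨s, hs, e⟩ := h1 t (α.comp hS.extClass rfl)
  rw [← comp_assoc _ _ _ (zero_add n) rfl (by simp)] at e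
  obtain ⟨β, hβ⟩ := covariant_sequence_exact₃ _ hS _ _ e
  obtain ⟨s', hs', e'⟩ := h2 s β
  refine ⟨s', hs.trans hs', ?_⟩
  rw [tr_comp_ext I hs hs', ← hβ, ← comp_assoc _ _ _ (zero_add n) (add_zero n) (by simp), e', Abelian.Ext.zero_comp]

/-- `g` kills `Ext` in degrees above `n`. -/
def ZA (n : ℕ) {A B : ModuleCat.{u} R} (g : A ⟶ B) : Prop :=
  ∀ m, n < m → ∀ (Y : ModuleCat.{u} R) (α : Abelian.Ext B Y m), (mk₀ g).comp α (zero_add _) = 0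

lemma ZA.comp_left {n : ℕ} {A B C : ModuleCat.{u} R} (f : A ⟶ B) {g : B ⟶ C} (h : ZA n g) :
    ZA n (f ≫ g) := by
  intro m hm Y α
  rw [← mk₀_comp_mk₀_assoc, h m hm, Abelian.Ext.comp_zero]

lemma ZA.comp_right {n : ℕ} {A B C : ModuleCat.{u} R} {f : A ⟶ B} (h : ZA n f) (g : B ⟶ C) :
    ZA n (f ≫ g) := by
  intro m hm Y α
  rw [← mk₀_comp_mk₀_assoc, h m hm]

lemma ZA.ses {n : ℕ} {S₁ S₂ S₃ : ShortComplex (ModuleCat.{u} R)} (h₁ : S₁.ShortExact)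
    (h₂ : S₂.ShortExact) (φ : S₁ ⟶ S₂) (ψ : S₂ ⟶ S₃) (hφ : ZA n φ.τ₁) (hψ : ZA n ψ.τ₂) :
    ZA (n+1) (φ.τ₃ ≫ ψ.τ₃) := by
  intro m hm Y α
  obtain ⟨m, rfl⟩ : ∃ k, m = 1 + k := ⟨m - 1, by omega⟩
  rw [← mk₀_comp_mk₀_assoc]
  have e : (mk₀ S₂.g).comp ((mk₀ ψ.τ₃).comp α (zero_add _)) (zero_add _) = 0 := by
    rw [mk₀_comp_mk₀_assoc, ← ψ.comm₂₃, ← mk₀_comp_mk₀_assoc, hψ _ (by omega)]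
  obtain ⟨γ, hγ⟩ := contravariant_sequence_exact₃ h₂ Y _ e rfl
  rw [← hγ, ← comp_assoc _ _ _ (zero_add 1) rfl (by simp),
    ← ShortComplex.ShortExact.extClass_naturality h₁ h₂ φ,
    comp_assoc _ _ _ (add_zero 1) (zero_add m) (by simp), hφ _ (by omega), Abelian.Ext.comp_zero]

/-- The pro-system of `R/I^t` has pro-projective dimension at most `n`. -/
def Bdd (I : Ideal R) (n : ℕ) : Prop :=
  ∀ t, ∃ (s : ℕ) (h : t ≤ s), ZA n (tr I h)

lemma Bdd.van {I : Ideal R} {n : ℕ} (h : Bdd I n) {m : ℕ} (hm : n < m) (Y : ModuleCat.{u} R) :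
    Van I m Y := by
  intro t α
  obtain ⟨s, hs, H⟩ := h t
  exact ⟨s, hs, H m hm Y α⟩

lemma Bdd.bot : Bdd (⊥ : Ideal R) 0 := by
  intro t
  refine ⟨t + 1, by omega, ?_⟩
  intro m hm Y α
  have hb : (⊥ : Ideal R) ^ (t+1) = ⊥ := by
    rw [← Ideal.zero_eq_bot, zero_pow (by omega)]
  have : Module.Projective R (R ⧸ (⊥ : Ideal R) ^ (t+1)) :=
    Module.Projective.of_equiv ((Submodule.quotEquivOfEqBot _ hb).symm)
  have : Projective (QP (⊥ : Ideal R) (t+1)) :=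
    (IsProjective.iff_projective (R := R) (R ⧸ (⊥ : Ideal R) ^ (t+1))).1 this
  obtain ⟨m, rfl⟩ : ∃ k, m = k + 1 := ⟨m - 1, by omega⟩
  exact eq_zero_of_projective _

section step

variable (b : Ideal R) (x : R)

/-- `(b^t : x^t)` -/
def kk (t : ℕ) : Ideal R := Submodule.comap (LinearMap.lsmul R R (x ^ t)) (b ^ t)

lemma mem_kk {t : ℕ} {r : R} : r ∈ kk b x t ↔ x ^ t * r ∈ b ^ t := Iff.rfl

/-- `(b^t, x^t)` -/
def cc (t : ℕ) : Ideal R := b ^ t ⊔ Ideal.span {x ^ t}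

/-- the multiplication sequence -/
def SS (t : ℕ) : ShortComplex (ModuleCat.{u} R) where
  X₁ := ModuleCat.of R (R ⧸ kk b x t)
  X₂ := ModuleCat.of R (R ⧸ b ^ t)
  X₃ := ModuleCat.of R (R ⧸ cc b x t)
  f := ModuleCat.ofHom (Submodule.mapQ _ _ (LinearMap.lsmul R R (x ^ t)) le_rfl)
  g := pj le_sup_left
  zero := by
    ext
    change Ideal.Quotient.mk _ (x ^ t * 1) = 0
    rw [Ideal.Quotient.eq_zero_iff_mem]
    exact Ideal.mem_sup_right (by simp)

lemma SS_exact (t : ℕ) : (SS b x t).ShortExact := by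
  refine ShortComplex.ShortExact.mk' ?_ ?_ ?_
  · rw [ShortComplex.moduleCat_exact_iff]
    intro y
    obtain ⟨y, rfl⟩ := Ideal.Quotient.mk_surjective (I := b ^ t) y
    intro hy
    replace hy : Ideal.Quotient.mk (cc b x t) y = 0 := hy
    rw [Ideal.Quotient.eq_zero_iff_mem] at hy
    obtain ⟨p, hp, q, hq, rfl⟩ := Submodule.mem_sup.1 hy
    obtain ⟨r, rfl⟩ := Ideal.mem_span_singleton.1 hq
    refine ⟨Ideal.Quotient.mk (kk b x t) r, ?_⟩
    change Ideal.Quotient.mk (b ^ t) (x ^ t * r) = _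
    rw [map_add, Ideal.Quotient.eq_zero_iff_mem.2 hp, zero_add]
  · rw [ModuleCat.mono_iff_injective]
    refine (injective_iff_map_eq_zero (ModuleCat.Hom.hom (SS b x t).f)).2 ?_
    intro y
    obtain ⟨y, rfl⟩ := Ideal.Quotient.mk_surjective (I := kk b x t) y
    intro hy
    replace hy : Ideal.Quotient.mk (b ^ t) (x ^ t * y) = 0 := hy
    rw [Ideal.Quotient.eq_zero_iff_mem] at hy
    exact Ideal.Quotient.eq_zero_iff_mem.2 hy
  · rw [ModuleCat.epi_iff_surjective]
    intro y
    obtain ⟨y, rfl⟩ := Ideal.Quotient.mk_surjective (I := cc b x t) y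
    exact ⟨Ideal.Quotient.mk (b ^ t) y, rfl⟩

lemma cc_le {t s : ℕ} (h : t ≤ s) : cc b x s ≤ cc b x t := by
  refine sup_le_sup (Ideal.pow_le_pow_right h) ?_
  rw [Ideal.span_singleton_le_span_singleton]
  exact pow_dvd_pow x h

lemma kk_le {t s : ℕ} (h : t ≤ s) :
    kk b x s ≤ Submodule.comap (LinearMap.lsmul R R (x ^ (s - t))) (kk b x t) := by
  intro r hr
  change x ^ t * (x ^ (s - t) * r) ∈ b ^ t
  rw [← mul_assoc, ← pow_add, Nat.add_sub_cancel' h]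
  exact Ideal.pow_le_pow_right h hr

/-- transition maps of sequences -/
def SSmap {t s : ℕ} (h : t ≤ s) : SS b x s ⟶ SS b x t where
  τ₁ := ModuleCat.ofHom (Submodule.mapQ _ _ (LinearMap.lsmul R R (x ^ (s - t))) (kk_le b x h))
  τ₂ := tr b h
  τ₃ := pj (cc_le b x h)
  comm₁₂ := by
    ext r
    obtain ⟨r, rfl⟩ := Ideal.Quotient.mk_surjective (I := kk b x s) r
    change Ideal.Quotient.mk (b ^ t) (x ^ t * (x ^ (s - t) * r)) =
      Ideal.Quotient.mk (b ^ t) (x ^ s * r)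
    rw [← mul_assoc, ← pow_add, Nat.add_sub_cancel' h]
  comm₂₃ := by
    ext r
    obtain ⟨r, rfl⟩ := Ideal.Quotient.mk_surjective (I := b ^ s) r
    rfl

variable [IsNoetherianRing R]

lemma exists_stab (J : Ideal R) : ∃ s, ∀ m r, x ^ m * r ∈ J → x ^ s * r ∈ J := by
  let F : ℕ →o Ideal R := ⟨fun m => Submodule.comap (LinearMap.lsmul R R (x ^ m)) J, by
    intro m m' h r hr
    change x ^ m' * r ∈ J
    obtain ⟨k, rfl⟩ := Nat.exists_eq_add_of_le h
    rw [pow_add, mul_comm (x ^ m), mul_assoc]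
    exact J.mul_mem_left _ hr⟩
  obtain ⟨s, hs⟩ := monotone_stabilizes_iff_noetherian.2 ‹IsNoetherianRing R› F
  refine ⟨s, fun m r hr => ?_⟩
  have h1 : r ∈ F (max s m) := F.mono (le_max_right s m) hr
  rw [← hs _ (le_max_left s m)] at h1
  exact h1

lemma exists_ZA_τ₁ {n : ℕ} (hb : Bdd b n) (t : ℕ) :
    ∃ (s : ℕ) (h : t ≤ s), ZA n (SSmap b x h).τ₁ := by
  obtain ⟨u, hu, H⟩ := hb t
  obtain ⟨s, hs⟩ := exists_stab x (b ^ u)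
  have hle : kk b x (u + s) ≤ Submodule.comap (LinearMap.lsmul R R (x ^ (u + s - t))) (b ^ u) := by
    intro r hr
    change x ^ (u + s - t) * r ∈ b ^ u
    have h1 : x ^ s * r ∈ b ^ u := hs (u + s) r (Ideal.pow_le_pow_right (by omega) hr)
    have : u + s - t = (u - t) + s := by omega
    rw [this, pow_add, mul_assoc]
    exact Ideal.mul_mem_left _ _ h1
  refine ⟨u + s, by omega, ?_⟩
  have hk : b ^ t ≤ kk b x t := fun r hr => Ideal.mul_mem_left _ _ hr
  have e : (SSmap b x (show t ≤ u + s by omega)).τ₁ =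
      ModuleCat.ofHom (Submodule.mapQ _ _ _ hle) ≫ tr b hu ≫ pj hk := by
    ext r
    obtain ⟨r, rfl⟩ := Ideal.Quotient.mk_surjective (I := kk b x (u + s)) r
    rfl
  rw [e]
  exact ZA.comp_left _ (H.comp_right _)

lemma Bdd.step {n : ℕ} (hb : Bdd b n) : Bdd (b ⊔ Ideal.span {x}) (n+1) := by
  intro t
  obtain ⟨t₂, h₂, H₂⟩ := hb t
  obtain ⟨t₃, h₃, H₃⟩ := exists_ZA_τ₁ b x hb t₂
  have H := ZA.ses (SS_exact b x t₃) (SS_exact b x t₂) (SSmap b x h₃) (SSmap b x h₂) H₃ H₂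
  have hA : (b ⊔ Ideal.span {x}) ^ (t₃ + t₃) ≤ cc b x t₃ := by
    refine (Ideal.sup_pow_add_le_pow_sup_pow).trans ?_
    rw [Ideal.span_singleton_pow]
    exact le_rfl
  have hB : cc b x t ≤ (b ⊔ Ideal.span {x}) ^ t := by
    refine sup_le (Ideal.pow_right_mono le_sup_left t) ?_
    rw [← Ideal.span_singleton_pow]
    exact Ideal.pow_right_mono le_sup_right t
  refine ⟨t₃ + t₃, by omega, ?_⟩
  have e : tr (b ⊔ Ideal.span {x}) (show t ≤ t₃ + t₃ by omega) =
    pj hA ≫ ((SSmap b x h₃).τ₃ ≫ (SSmap b x h₂).τ₃) ≫ pj hB := by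
    ext
    rfl
  rw [e]
  exact ZA.comp_left _ (H.comp_right _)

lemma exists_bdd (I : Ideal R) : ∃ n, Bdd I n := by
  classical
  obtain ⟨s, rfl⟩ := IsNoetherian.noetherian I
  induction s using Finset.induction_on with
  | empty => exact ⟨0, by simpa using Bdd.bot⟩
  | insert a s _ ih =>
    obtain ⟨n, hn⟩ := ih
    refine ⟨n + 1, ?_⟩
    have := hn.step _ a
    rw [Finset.coe_insert]
    rw [show Submodule.span R (insert a (s : Set R)) = Submodule.span R (s : Set R) ⊔
      Ideal.span {a} by rw [Submodule.span_insert, sup_comm]]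
    exact this

end step

end chases

section main

open Abelian.Ext

variable {R : Type u} [CommRing R]

lemma Van.of_iso {I : Ideal R} {n : ℕ} {X Y : ModuleCat.{u} R} (e : X ≅ Y) (h : Van I n X) :
    Van I n Y := by
  intro t α
  obtain ⟨s, hs, H⟩ := h t (α.comp (mk₀ e.inv) (add_zero _))
  refine ⟨s, hs, ?_⟩
  have h1 : α = (α.comp (mk₀ e.inv) (add_zero _)).comp (mk₀ e.hom) (add_zero _) := by
    rw [comp_assoc _ _ _ (add_zero n) (add_zero 0) (by simp), mk₀_comp_mk₀, e.inv_hom_id,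
      comp_mk₀_id]
  rw [h1, ← comp_assoc _ _ _ (zero_add n) (add_zero n) (by simp), H, Abelian.Ext.zero_comp]

lemma Van.of_subsingleton (I : Ideal R) (n : ℕ) (N : Type u) [AddCommGroup N] [Module R N]
    [Subsingleton N] : Van I n (ModuleCat.of R N) := by
  intro t α
  refine ⟨t, le_rfl, ?_⟩
  have h0 : 𝟙 (ModuleCat.of R N) = 0 := by
    ext x
    exact Subsingleton.elim _ _
  have : α = 0 := by
    rw [← comp_mk₀_id α, h0, mk₀_zero, Abelian.Ext.comp_zero]
  rw [this, Abelian.Ext.comp_zero]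

lemma ses {N₁ N₂ N₃ : Type u} [AddCommGroup N₁] [Module R N₁] [AddCommGroup N₂] [Module R N₂]
    [AddCommGroup N₃] [Module R N₃] (f : N₁ →ₗ[R] N₂) (g : N₂ →ₗ[R] N₃)
    (hf : Function.Injective f) (hg : Function.Surjective g) (hfg : Function.Exact f g) :
    (ShortComplex.mk (ModuleCat.ofHom f) (ModuleCat.ofHom g)
      (by ext x; exact hfg.apply_apply_eq_zero x)).ShortExact :=
  ModuleCat.shortComplex_shortExact _ hfg hf hg

lemma van_of_primes [IsNoetherianRing R] (I : Ideal R) (j : ℕ) (N : Type u) [AddCommGroup N]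
    [Module R N] [hN : Module.Finite R N] :
    (∀ q : Ideal R, q.IsPrime → Module.annihilator R N ≤ q → Van I j (ModuleCat.of R (R ⧸ q))) →
    Van I j (ModuleCat.of R N) := by
  induction hN using IsNoetherianRing.induction_on_isQuotientEquivQuotientPrime R with
  | subsingleton N => exact fun _ => Van.of_subsingleton I j N
  | quotient N p e =>
    intro H
    refine Van.of_iso e.symm.toModuleIso (H p.1 p.2 ?_)
    rw [e.annihilator_eq, Ideal.annihilator_quotient]
  | exact N₁ N₂ N₃ f g hf hg hfg ih₁ ih₃ =>
    intro H
    exact Van.X₂ (ses f g hf hg hfg)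
      (ih₁ fun q hq h => H q hq ((f.annihilator_le_of_injective hf).trans h))
      (ih₃ fun q hq h => H q hq ((g.annihilator_le_of_surjective hg).trans h))

lemma exists_map [IsNoetherianRing R] (M : Type u) [AddCommGroup M] [Module R M]
    [Module.Finite R M] (q : Ideal R) (hq : q.IsPrime) (h : Module.annihilator R M ≤ q) :
    ∃ φ : M →ₗ[R] (R ⧸ q), φ ≠ 0 := by
  by_contra! H
  have hs : Subsingleton (M →ₗ[R] (R ⧸ q)) := ⟨fun a b => (H a).trans (H b).symm⟩
  obtain ⟨r, hr, hreg⟩ := IsSMulRegular.subsingleton_linearMap_iff.1 hs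
  have h1 : r • (1 : R ⧸ q) = r • (0 : R ⧸ q) := by
    rw [smul_zero, Algebra.smul_def, mul_one]
    exact Ideal.Quotient.eq_zero_iff_mem.2 (h hr)
  exact one_ne_zero (hreg h1)

lemma van_prime [IsNoetherianRing R] (I : Ideal R) (M : Type u) [AddCommGroup M] [Module R M]
    [Module.Finite R M] (j : ℕ) (hM : Van I j (ModuleCat.of R M))
    (ih : ∀ K : Submodule R M, Van I (j+1) (ModuleCat.of R K))
    (q : Ideal R) : q.IsPrime → Module.annihilator R M ≤ q → Van I j (ModuleCat.of R (R ⧸ q)) := by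
  induction q using WellFoundedGT.induction with
  | ind q ihq =>
  intro hq hle
  obtain ⟨φ, hφ⟩ := exists_map M q hq hle
  have hL : Van I j (ModuleCat.of R (LinearMap.range φ)) := by
    refine Van.X₃ (ses (LinearMap.ker φ).subtype φ.rangeRestrict
      (Submodule.subtype_injective _) φ.surjective_rangeRestrict ?_) hM (ih _)
    rw [LinearMap.exact_iff]
    simp
  refine Van.X₂ (ses (LinearMap.range φ).subtype (LinearMap.range φ).mkQ
    (Submodule.subtype_injective _) (Submodule.mkQ_surjective _) ?_) hL ?_
  · rw [LinearMap.exact_iff]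
    simp
  · apply van_of_primes
    intro q' hq' hle'
    have h1 : q ≤ Module.annihilator R ((R ⧸ q) ⧸ LinearMap.range φ) := by
      refine le_trans ?_ (LinearMap.annihilator_le_of_surjective _
        (Submodule.mkQ_surjective (LinearMap.range φ)))
      rw [Ideal.annihilator_quotient]
    have h2 : ∃ a ∈ Module.annihilator R ((R ⧸ q) ⧸ LinearMap.range φ), a ∉ q := by
      obtain ⟨m, hm⟩ : ∃ m, φ m ≠ 0 := by
        by_contra! H
        exact hφ (LinearMap.ext H)
      obtain ⟨a, ha⟩ := Ideal.Quotient.mk_surjective (φ m)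
      refine ⟨a, ?_, fun haq => hm ?_⟩
      · rw [Module.mem_annihilator]
        intro y
        obtain ⟨y, rfl⟩ := Submodule.mkQ_surjective _ y
        obtain ⟨r, rfl⟩ := Ideal.Quotient.mk_surjective y
        rw [← map_smul, Submodule.mkQ_apply, Submodule.Quotient.mk_eq_zero]
        refine ⟨r • m, ?_⟩
        rw [map_smul, ← ha, Algebra.smul_def, Algebra.smul_def, mul_comm]
        rfl
      · rw [← ha, Ideal.Quotient.eq_zero_iff_mem]
        exact haq
    obtain ⟨a, ha, haq⟩ := h2
    refine ihq q' (lt_of_le_of_ne (h1.trans hle') ?_) hq' ((hle.trans h1).trans hle')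
    rintro rfl
    exact haq (hle' ha)

lemma van_main [IsNoetherianRing R] (I : Ideal R) (M : Type u) [AddCommGroup M] [Module R M]
    [Module.Finite R M] (i : ℕ) (hM : ∀ j, i < j → Van I j (ModuleCat.of R M)) (j : ℕ) (hj : i < j)
    (N : Type u) [AddCommGroup N] [Module R N] [Module.Finite R N]
    (hN : Module.annihilator R M ≤ Module.annihilator R N) : Van I j (ModuleCat.of R N) := by
  obtain ⟨n, hn⟩ := exists_bdd I
  have key : ∀ k j, i < j → n < j + k → ∀ (N : Type u) [AddCommGroup N] [Module R N]
      [Module.Finite R N], Module.annihilator R M ≤ Module.annihilator R N →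
      Van I j (ModuleCat.of R N) := by
    intro k
    induction k with
    | zero =>
      intro j _ hnj N _ _ _ _
      exact hn.van hnj _
    | succ k ih =>
      intro j hij hnj N _ _ _ hN
      apply van_of_primes
      intro q hq hle
      refine van_prime I M j (hM j hij) ?_ q hq (hN.trans hle)
      intro K
      exact ih (j+1) (by omega) (by omega) K
        (K.subtype.annihilator_le_of_injective (Submodule.subtype_injective _))
  exact key (n + 1) j hj (by omega) N hN

lemma cohDim_le_iff (I : Ideal R) (N : Type u) [AddCommGroup N] [Module R N] (i : ℕ) :
    cohDim I N ≤ (i : ℕ∞) ↔ ∀ j, i < j → Van I j (ModuleCat.of R N) := by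
  rw [cohDim, sSup_le_iff]
  constructor
  · intro H j hj
    obtain ⟨j, rfl⟩ : ∃ k, j = k + 1 := ⟨j - 1, by omega⟩
    rw [van_iff]
    intro hnz
    have := H _ ⟨j + 1, rfl, hnz⟩
    have h2 : j + 1 ≤ i := by exact_mod_cast this
    omega
  · rintro H _ ⟨j, rfl, hnz⟩
    by_contra hlt
    have hij : i < j := by
      by_contra h
      exact hlt (by exact_mod_cast not_lt.1 h)
    obtain ⟨j, rfl⟩ : ∃ k, j = k + 1 := ⟨j - 1, by omega⟩
    exact (van_iff I j (ModuleCat.of R N)).1 (H _ hij) hnz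

lemma cohDim_le_of_equiv (I : Ideal R) {N N' : Type u} [AddCommGroup N] [Module R N]
    [AddCommGroup N'] [Module R N'] (e : N ≃ₗ[R] N') (i : ℕ) (h : cohDim I N ≤ (i : ℕ∞)) :
    cohDim I N' ≤ (i : ℕ∞) := by
  rw [cohDim_le_iff] at h ⊢
  exact fun j hj => (h j hj).of_iso e.toModuleIso

end main

end LCAux

/-- `Ass_R (M_i) = {p ∈ Ass_R M : cd(𝔞, R/p) ≤ i}` for `M_i` the largest submodule of `M`
with `cd(𝔞, M_i) ≤ i`. -/
theorem stmt_3 {R : Type u} [CommRing R] [IsNoetherianRing R] (𝔞 : Ideal R)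
    (M : Type u) [AddCommGroup M] [Module R M] [Module.Finite R M] [Nontrivial M]
    (c : ℕ) (hc : cohDim 𝔞 M = (c : ℕ∞)) (i : ℕ) (hi : i ≤ c)
    (Mi : Submodule R M) (hMi : cohDim 𝔞 ↥Mi ≤ (i : ℕ∞))
    (hMimax : ∀ L : Submodule R M, cohDim 𝔞 ↥L ≤ (i : ℕ∞) → L ≤ Mi) :
    associatedPrimes R ↥Mi =
      {p ∈ associatedPrimes R M | cohDim 𝔞 (R ⧸ p) ≤ (i : ℕ∞)} := by 
  ext p
  constructor
  · intro hp
    refine ⟨associatedPrimes.subset_of_injective (Submodule.subtype_injective Mi) hp, ?_⟩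
    rw [LCAux.cohDim_le_iff] at hMi ⊢
    intro j hj
    refine LCAux.van_main 𝔞 Mi i hMi j hj (R ⧸ p) ?_
    rw [Ideal.annihilator_quotient]
    exact le_of_eq_of_le Submodule.annihilator_top.symm (IsAssociatedPrime.annihilator_le hp)
  · rintro ⟨hp, hle⟩
    obtain ⟨hpr, f, hf⟩ := (isAssociatedPrime_iff_exists_injective_linearMap _ _).1 hp
    have hL : LinearMap.range f ≤ Mi :=
      hMimax _ (LCAux.cohDim_le_of_equiv 𝔞 (LinearEquiv.ofInjective f hf) i hle)
    refine (isAssociatedPrime_iff_exists_injective_linearMap _ _).2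
      ⟨hpr, f.codRestrict Mi (fun x => hL ⟨x, rfl⟩), ?_⟩
    intro a b hab
    exact hf (congrArg Subtype.val hab)
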